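/- Let 1 < p < ∞ with conjugate exponent p′, and let 1 ≤ q < ∞. Let E ⊆ ℓᵖ be a nonempty compact subset (in the ℓᵖ norm topology), and let η : ℝ → ℝ be continuous and not a polynomial on any nonempty open interval. Then for every continuous map F : E → ℓ^q and every ε > 0 there exist m ∈ ℕ, sequences a_1,…,a_m ∈ ℓ^{p′}, reals θ_1,…,θ_m, and vectors v_1,…,v_m ∈ ℓ^q such that sup_{s ∈ E} ‖F(s) − Σ_{j=1}^m η(Σ_{n=1}^∞ a_{j,n} s_n − θ_j) • v_j‖_{ℓ^q} < ε. -/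

import Mathlib

/-- `η` is not equal to any polynomial on any nonempty open interval of `ℝ`. -/
def NotPolynomialOnAnyInterval (η : ℝ → ℝ) : Prop :=
  ∀ (a b : ℝ), a < b → ∀ P : Polynomial ℝ, ∃ x ∈ Set.Ioo a b, η x ≠ P.eval x

open MeasureTheory ContinuousLinearMap Filter Topology ContDiff Convolution

section RidgeFunctions

variable {X : Type*} [TopologicalSpace X] [CompactSpace X]

theorem Submodule.integral_mem_of_isClosed {V : Type*} [NormedAddCommGroup V] [NormedSpace ℝ V]
    [CompleteSpace V] {S : Submodule ℝ V} (hS : IsClosed (S : Set V)) {f : ℝ → V}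
    (hcont : Continuous f) (hint : Integrable f) (hf : ∀ t, f t ∈ S) : ∫ t, f t ∈ S := by
  have : CompleteSpace S := hS.completeSpace_coe
  have hi : Integrable fun t => (⟨f t, hf t⟩ : S) :=
    hint.mono (hcont.subtype_mk hf).aestronglyMeasurable (ae_of_all _ fun t => le_rfl)
  have := S.subtypeL.integral_comp_comm hi
  simp only [Submodule.subtypeL_apply] at this
  rw [this]
  exact Subtype.mem _

theorem Submodule.mem_of_hasDerivAt {V : Type*} [NormedAddCommGroup V] [NormedSpace ℝ V]
    {S : Submodule ℝ V} (hS : IsClosed (S : Set V)) {f : ℝ → V} {f' : V} {c : ℝ}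
    (hf : ∀ t, f t ∈ S) (h : HasDerivAt f f' c) : f' ∈ S :=
  hS.mem_of_tendsto h.tendsto_slope
    (Eventually.of_forall fun t => S.smul_mem _ (S.sub_mem (hf t) (hf c)))

theorem ContinuousMap.hasDerivAt_comp_smul_sub (a : C(X, ℝ)) (θ : ℝ) (g g' : C(ℝ, ℝ))
    (h : ∀ x, HasDerivAt g (g' x) x) (c : ℝ) :
    HasDerivAt (fun t : ℝ => g.comp (t • a - const X θ))
      (a * g'.comp (c • a - const X θ)) c := by
  have hcont : Continuous fun t : ℝ => a * g'.comp (t • a - const X θ) := by fun_prop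
  have key : (fun t : ℝ => g.comp (t • a - const X θ)) =
      fun t => (∫ u in (0 : ℝ)..t, a * g'.comp (u • a - const X θ)) + const X (g (-θ)) := by
    funext t
    ext x
    let ev : C(X, ℝ) →L[ℝ] ℝ := ContinuousMap.evalCLM ℝ x
    have h1 : ev (∫ u in (0 : ℝ)..t, a * g'.comp (u • a - const X θ)) =
        ∫ u in (0 : ℝ)..t, ev (a * g'.comp (u • a - const X θ)) :=
      (ev.intervalIntegral_comp_comm (hcont.intervalIntegrable 0 t)).symm
    have h2 : ∫ u in (0 : ℝ)..t, a x * g' (u * a x - θ) = g (t * a x - θ) - g (0 * a x - θ) := by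
      apply intervalIntegral.integral_eq_sub_of_hasDerivAt (f := fun u => g (u * a x - θ))
      · intro u _
        have := (h (u * a x - θ)).comp u (((hasDerivAt_id u).mul_const (a x)).sub_const θ)
        simpa [Function.comp_def, mul_comm] using this
      · exact Continuous.intervalIntegrable (by fun_prop) _ _
    change g (t * a x - θ) = ev (∫ u in (0 : ℝ)..t, a * g'.comp (u • a - const X θ)) + g (-θ)
    rw [h1]
    change g (t * a x - θ) = (∫ u in (0 : ℝ)..t, a x * g' (u * a x - θ)) + g (-θ)
    rw [h2]
    simp
  rw [key]
  exact (hcont.integral_hasStrictDerivAt 0 c).hasDerivAt.add_const _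

/-- The ridge functions `g (a - θ)` with profile `g` and `a ∈ A` all belong to `S`. -/
def RidgeProfile (S A : Submodule ℝ C(X, ℝ)) (g : C(ℝ, ℝ)) : Prop :=
  ∀ a ∈ A, ∀ θ : ℝ, g.comp (a - ContinuousMap.const X θ) ∈ S

variable {S A : Submodule ℝ C(X, ℝ)}

theorem RidgeProfile.pow_mul_mem (hS : IsClosed (S : Set C(X, ℝ))) {g : C(ℝ, ℝ)}
    (hg : RidgeProfile S A g) (hsmooth : ContDiff ℝ ∞ g) {a : C(X, ℝ)} (ha : a ∈ A) (θ : ℝ) (k : ℕ) :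
    ∀ c : ℝ, a ^ k * (⟨iteratedDeriv k g, hsmooth.continuous_iteratedDeriv k
      (mod_cast le_top)⟩ : C(ℝ, ℝ)).comp (c • a - ContinuousMap.const X θ) ∈ S := by
  induction k with
  | zero =>
    intro c
    have := hg (c • a) (A.smul_mem c ha) θ
    convert this using 1
    ext x
    simp
  | succ k ih =>
    intro c
    have hd := ContinuousMap.hasDerivAt_comp_smul_sub a θ
      ⟨iteratedDeriv k g, hsmooth.continuous_iteratedDeriv k (mod_cast le_top)⟩
      ⟨iteratedDeriv (k + 1) g, hsmooth.continuous_iteratedDeriv (k + 1) (mod_cast le_top)⟩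
      (fun x => by
        have := (hsmooth.differentiable_iteratedDeriv k (mod_cast ENat.natCast_lt_top k) x).hasDerivAt
        simpa [iteratedDeriv_succ] using this) c
    have := Submodule.mem_of_hasDerivAt hS ih (hd.const_mul (a ^ k))
    rwa [← mul_assoc, ← pow_succ] at this

theorem RidgeProfile.convolution (hS : IsClosed (S : Set C(X, ℝ))) {g h : C(ℝ, ℝ)}
    (hg : RidgeProfile S A g) {φ : ℝ → ℝ} (hφ : Continuous φ) (hφc : HasCompactSupport φ)
    (hh : ⇑h = φ ⋆[lsmul ℝ ℝ, volume] g) : RidgeProfile S A h := by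
  intro a ha θ
  have hcont : Continuous fun t : ℝ => φ t • g.comp (a - ContinuousMap.const X (θ + t)) := by
    fun_prop
  have hint : Integrable fun t : ℝ => φ t • g.comp (a - ContinuousMap.const X (θ + t)) :=
    hcont.integrable_of_hasCompactSupport hφc.smul_right
  have : h.comp (a - ContinuousMap.const X θ) =
      ∫ t, φ t • g.comp (a - ContinuousMap.const X (θ + t)) := by
    ext x
    rw [ContinuousMap.integral_apply hint]
    simp [hh, convolution_def, sub_sub]
  rw [this]
  exact Submodule.integral_mem_of_isClosed hS hcont hint fun t => S.smul_mem _ (hg a ha _)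

/-- A function whose `k`-th derivative vanishes is a polynomial of degree `< k`. -/
theorem exists_polynomial_of_iteratedDeriv_eq_zero (k : ℕ) {g : ℝ → ℝ} (hg : ContDiff ℝ ∞ g)
    (h : ∀ x, iteratedDeriv k g x = 0) : ∃ P : Polynomial ℝ, P.degree < k ∧ ∀ x, g x = P.eval x := by
  induction k generalizing g with
  | zero => exact ⟨0, by simp, by simpa using h⟩
  | succ k ih =>
    obtain ⟨P, hP, hPg⟩ := ih (g := deriv g) (contDiff_infty_iff_deriv.1 hg).2
      (by simpa [iteratedDeriv_succ'] using h)
    let Q : Polynomial ℝ := ∑ i ∈ Finset.range k, Polynomial.monomial (i + 1) (P.coeff i / (i + 1))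
    have hQ : Q.derivative = P := by
      have hsum : ∑ i ∈ Finset.range k, Polynomial.monomial i (P.coeff i) = P := by
        ext n
        by_cases hn : n < k
        · simp [Polynomial.coeff_monomial, hn]
        · have : P.coeff n = 0 := Polynomial.coeff_eq_zero_of_degree_lt
            (hP.trans_le (mod_cast not_lt.1 hn))
          simp [Polynomial.coeff_monomial, this]
      conv_rhs => rw [← hsum]
      simp only [Q, Polynomial.derivative_sum, Polynomial.derivative_monomial]
      refine Finset.sum_congr rfl fun i _ => ?_
      have : (i + 1 : ℝ) ≠ 0 := by positivity
      simp [this]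
    have hconst : ∀ x, g x - Q.eval x = g 0 - Q.eval 0 := by
      intro x
      have hd : ∀ y, HasDerivAt (fun y => g y - Q.eval y) 0 y := fun y => by
        have := ((hg.differentiable (by simp)) y).hasDerivAt.sub (Q.hasDerivAt y)
        rwa [hQ, hPg, sub_self] at this
      exact is_const_of_deriv_eq_zero (fun y => (hd y).differentiableAt) (fun y => (hd y).deriv) x 0
    refine ⟨Q + Polynomial.C (g 0 - Q.eval 0), ?_, fun x => ?_⟩
    · refine (Polynomial.degree_add_le _ _).trans_lt (max_lt ?_ ?_)
      · refine (Polynomial.degree_sum_le _ _).trans_lt ?_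
        rw [Finset.sup_lt_iff (WithBot.bot_lt_coe _)]
        intro i hi
        refine (Polynomial.degree_monomial_le _ _).trans_lt ?_
        exact_mod_cast Nat.succ_lt_succ (Finset.mem_range.1 hi)
      · exact Polynomial.degree_C_le.trans_lt (mod_cast Nat.succ_pos k)
    · rw [Polynomial.eval_add, Polynomial.eval_C, ← hconst x]
      ring

/-- A pointwise limit of polynomials of degree `< k` is a polynomial. -/
theorem exists_polynomial_of_tendsto (k : ℕ) {P : ℕ → Polynomial ℝ} (hP : ∀ n, (P n).degree < k)
    {g : ℝ → ℝ} (h : ∀ x, Tendsto (fun n => (P n).eval x) atTop (𝓝 (g x))) :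
    ∃ Q : Polynomial ℝ, ∀ x, g x = Q.eval x := by
  have hinj : Set.InjOn (fun i : ℕ => (i : ℝ)) (Finset.range k) := Nat.cast_injective.injOn
  refine ⟨Lagrange.interpolate (Finset.range k) (fun i : ℕ => (i : ℝ)) fun i => g i, fun x => ?_⟩
  refine tendsto_nhds_unique (h x) ?_
  have : ∀ n, (P n).eval x = (Lagrange.interpolate (Finset.range k) (fun i : ℕ => (i : ℝ))
      fun i => (P n).eval (i : ℝ)).eval x := fun n => by
    rw [← Lagrange.eq_interpolate hinj (by simpa using hP n)]
  simp only [this, Lagrange.interpolate_apply, Polynomial.eval_finsetSum, Polynomial.eval_mul,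
    Polynomial.eval_C]
  exact tendsto_finsetSum _ fun i _ => (h i).mul_const _

theorem RidgeProfile.pow_mem (hS : IsClosed (S : Set C(X, ℝ))) {g : C(ℝ, ℝ)}
    (hg : RidgeProfile S A g) (hpoly : ¬ ∃ P : Polynomial ℝ, ∀ x, g x = P.eval x)
    {a : C(X, ℝ)} (ha : a ∈ A) (k : ℕ) : a ^ k ∈ S := by
  by_contra hk
  let φ : ℕ → ContDiffBump (0 : ℝ) := fun n =>
    ⟨1 / ((n : ℝ) + 1) / 2, 1 / ((n : ℝ) + 1), by positivity, half_lt_self (by positivity)⟩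
  have hφ : Tendsto (fun n => (φ n).rOut) atTop (𝓝 0) := tendsto_one_div_add_atTop_nhds_zero_nat
  let G : ℕ → ℝ → ℝ := fun n => (φ n).normed volume ⋆[lsmul ℝ ℝ, volume] g
  have hG : ∀ n, ContDiff ℝ ∞ (G n) := fun n =>
    (φ n).hasCompactSupport_normed.contDiff_convolution_left _ (φ n).contDiff_normed
      g.continuous.locallyIntegrable
  have hzero : ∀ n x, iteratedDeriv k (G n) x = 0 := by
    intro n x
    by_contra hx
    have hprof : RidgeProfile S A ⟨G n, (hG n).continuous⟩ :=
      hg.convolution hS (φ n).continuous_normed (φ n).hasCompactSupport_normed rfl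
    have hmem := S.smul_mem (iteratedDeriv k (G n) x)⁻¹ (hprof.pow_mul_mem hS (hG n) ha (-x) k 0)
    apply hk
    convert hmem using 1
    ext y
    simp
    field_simp
  choose P hP hPG using fun n => exists_polynomial_of_iteratedDeriv_eq_zero k (hG n) (hzero n)
  refine hpoly (exists_polynomial_of_tendsto k hP fun x => ?_)
  simp only [← hPG]
  exact ContDiffBump.convolution_tendsto_right_of_continuous hφ g.continuous x

theorem RidgeProfile.eq_top (hS : IsClosed (S : Set C(X, ℝ)))
    (hA : ∀ ⦃x y : X⦄, x ≠ y → ∃ a ∈ A, a x ≠ a y) {g : C(ℝ, ℝ)}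
    (hg : RidgeProfile S A g) (hpoly : ¬ ∃ P : Polynomial ℝ, ∀ x, g x = P.eval x) : S = ⊤ := by
  have hexp : ∀ a ∈ A, NormedSpace.exp a ∈ S := fun a ha =>
    hS.mem_of_tendsto (NormedSpace.exp_series_hasSum_exp' (𝕂 := ℝ) a)
      (Eventually.of_forall fun s => S.sum_mem fun k _ => S.smul_mem _ (hg.pow_mem hS hpoly ha k))
  let M : Submonoid C(X, ℝ) :=
    { carrier := NormedSpace.exp '' (A : Set C(X, ℝ))
      one_mem' := ⟨0, A.zero_mem, NormedSpace.exp_zero⟩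
      mul_mem' := by
        rintro _ _ ⟨a, ha, rfl⟩ ⟨b, hb, rfl⟩
        exact ⟨a + b, A.add_mem ha hb, NormedSpace.exp_add⟩ }
  let B : Subalgebra ℝ C(X, ℝ) := Algebra.adjoin ℝ (M : Set C(X, ℝ))
  have hBS : (B : Set C(X, ℝ)) ⊆ S := by
    have : Subalgebra.toSubmodule B ≤ S := by
      rw [Algebra.adjoin_eq_span_of_subset]
      · rw [Submodule.span_le]
        rintro _ ⟨a, ha, rfl⟩
        exact hexp a ha
      · rw [Submonoid.closure_eq]
        exact Submodule.subset_span
    exact this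
  have hsep : B.SeparatesPoints := by
    intro x y hxy
    obtain ⟨a, ha, hne⟩ := hA hxy
    refine ⟨_, ⟨NormedSpace.exp a, Algebra.subset_adjoin ⟨a, ha, rfl⟩, rfl⟩, ?_⟩
    have hev : ∀ z, NormedSpace.exp a z = Real.exp (a z) := fun z => by
      rw [Real.exp_eq_exp_ℝ]
      exact NormedSpace.map_exp (ContinuousMap.evalAlgHom ℝ ℝ z)
        (ContinuousMap.evalCLM ℝ z : C(X, ℝ) →L[ℝ] ℝ).continuous a
    simpa [hev] using hne
  refine eq_top_iff.2 fun f _ => hS.closure_subset_iff.2 hBS ?_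
  exact ContinuousMap.continuousMap_mem_subalgebra_closure_of_separatesPoints B hsep f

end RidgeFunctions

section VectorValued

variable {X Y : Type*} [TopologicalSpace X] [CompactSpace X] [T2Space X]
  [NormedAddCommGroup Y] [NormedSpace ℝ Y]

/-- Finite sums of scalar continuous functions times vectors are uniformly dense. -/
theorem ContinuousMap.exists_norm_sub_sum_smul_lt (F : C(X, Y)) {ε : ℝ} (hε : 0 < ε) :
    ∃ (t : Finset X) (ρ : X → C(X, ℝ)), ∀ x, ‖F x - ∑ i ∈ t, ρ i x • F i‖ < ε := by
  obtain ⟨t, ht⟩ := isCompact_univ.elim_finite_subcover (fun i : X => F ⁻¹' Metric.ball (F i) ε)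
    (fun i => Metric.isOpen_ball.preimage F.continuous)
    (fun x _ => Set.mem_iUnion.2 ⟨x, Metric.mem_ball_self hε⟩)
  obtain ⟨ρ, hρ⟩ := PartitionOfUnity.exists_isSubordinate isClosed_univ
    (fun i : t => F ⁻¹' Metric.ball (F i) ε)
    (fun i => Metric.isOpen_ball.preimage F.continuous) (by simpa [Set.iUnion_subtype] using ht)
  classical
  refine ⟨t, fun i => if h : i ∈ t then ρ ⟨i, h⟩ else 0, fun x => ?_⟩
  have hmem : ∑ᶠ i : t, ρ i x • F i ∈ Metric.ball (F x) ε := by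
    refine (convex_ball (F x) ε).finsum_mem (fun i => ρ.nonneg i x)
      (ρ.sum_eq_one (Set.mem_univ x)) fun i hi => ?_
    rw [Metric.mem_ball_comm]
    exact hρ i (subset_tsupport _ hi)
  rw [finsum_eq_sum_of_fintype, mem_ball_iff_norm'] at hmem
  rw [← t.sum_coe_sort]
  simpa using hmem

theorem RidgeProfile.exists_norm_sub_sum_lt (A : Submodule ℝ C(X, ℝ))
    (hA : ∀ ⦃x y : X⦄, x ≠ y → ∃ a ∈ A, a x ≠ a y) (g : C(ℝ, ℝ))
    (hpoly : ¬ ∃ P : Polynomial ℝ, ∀ x, g x = P.eval x) (F : C(X, Y)) {ε : ℝ} (hε : 0 < ε) :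
    ∃ (m : ℕ) (a : Fin m → A) (θ : Fin m → ℝ) (v : Fin m → Y),
      ∀ x, ‖F x - ∑ j, g ((a j : C(X, ℝ)) x - θ j) • v j‖ < ε := by
  let R : Set C(X, ℝ) := {f | ∃ a ∈ A, ∃ θ : ℝ, f = g.comp (a - ContinuousMap.const X θ)}
  let Λ : Y → C(X, ℝ) →L[ℝ] C(X, Y) := fun v =>
    (ContinuousLinearMap.toSpanSingleton ℝ v).compLeftContinuous ℝ X
  let T : Submodule ℝ C(X, Y) := Submodule.span ℝ {f | ∃ h ∈ R, ∃ v, f = Λ v h}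
  have htop : (Submodule.span ℝ R).topologicalClosure = ⊤ :=
    RidgeProfile.eq_top (A := A) (Submodule.isClosed_topologicalClosure _) hA
      (fun a ha θ => Submodule.le_topologicalClosure _ (Submodule.subset_span ⟨a, ha, θ, rfl⟩)) hpoly
  have hΛ : ∀ f v, Λ v f ∈ T.topologicalClosure := by
    intro f v
    have hf : f ∈ (Submodule.span ℝ R).topologicalClosure := htop ▸ Submodule.mem_top
    refine map_mem_closure (Λ v).continuous hf fun h hh => ?_
    have : Submodule.span ℝ R ≤ T.comap (Λ v : C(X, ℝ) →ₗ[ℝ] C(X, Y)) :=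
      Submodule.span_le.2 fun r hr => Submodule.subset_span ⟨r, hr, v, rfl⟩
    exact this hh
  obtain ⟨t, ρ, hρ⟩ := F.exists_norm_sub_sum_smul_lt (half_pos hε)
  have hmem : ∑ i ∈ t, Λ (F i) (ρ i) ∈ T.topologicalClosure :=
    Submodule.sum_mem _ fun i _ => hΛ _ _
  obtain ⟨G, hGT, hG⟩ := Metric.mem_closure_iff.1 hmem (ε / 2) (half_pos hε)
  obtain ⟨m, c, f, hf⟩ := Submodule.mem_span_set'.1 hGT
  choose r hr v hv using fun j => (f j).2
  choose a ha θ hr using hr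
  refine ⟨m, fun j => ⟨a j, ha j⟩, θ, fun j => c j • v j, fun x => ?_⟩
  have hGx : G x = ∑ j, g (a j x - θ j) • c j • v j := by
    rw [← hf, ContinuousMap.sum_apply]
    refine Finset.sum_congr rfl fun j _ => ?_
    rw [ContinuousMap.smul_apply, hv, hr, smul_comm]
    rfl
  have h1 : ‖F x - (∑ i ∈ t, Λ (F i) (ρ i)) x‖ < ε / 2 := by
    rw [ContinuousMap.sum_apply]
    exact hρ x
  have h2 : ‖(∑ i ∈ t, Λ (F i) (ρ i)) x - G x‖ < ε / 2 := by
    rw [← dist_eq_norm]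
    exact (ContinuousMap.dist_apply_le_dist x).trans_lt hG
  rw [← hGx]
  linarith [norm_sub_le_norm_sub_add_norm_sub (F x) ((∑ i ∈ t, Λ (F i) (ρ i)) x) (G x)]

end VectorValued

/-- The restrictions to `E` of finite linear combinations of coordinate functionals on `ℓᵖ`. -/
noncomputable def lp.coordinateSpan (p : ENNReal) [Fact (1 ≤ p)]
    (E : Set (lp (fun _ : ℕ => ℝ) p)) : Submodule ℝ C(E, ℝ) :=
  Submodule.span ℝ (Set.range fun i : ℕ =>
    ⟨fun s => s.1 i, (lp.lipschitzWith_one_eval p i).continuous.comp continuous_subtype_val⟩)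

theorem lp.exists_tsum_of_mem_coordinateSpan {p p' : ENNReal} [Fact (1 ≤ p)]
    (hpp' : p'.toReal.HolderConjugate p.toReal) {E : Set (lp (fun _ : ℕ => ℝ) p)}
    {f : C(E, ℝ)} (hf : f ∈ lp.coordinateSpan p E) :
    ∃ a : lp (fun _ : ℕ => ℝ) p', ∀ s : E, f s = ∑' n, a n * s.1 n := by
  have hsumm : ∀ (a : lp (fun _ : ℕ => ℝ) p') (s : E), Summable fun n => a n * s.1 n :=
    fun a s => Summable.of_norm (by simpa using lp.summable_mul hpp' a s.1)
  induction hf using Submodule.span_induction with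
  | mem x hx =>
    obtain ⟨i, rfl⟩ := hx
    refine ⟨lp.single p' i 1, fun s => ?_⟩
    rw [tsum_eq_single i]
    · simp
    · intro n hn
      simp [hn]
  | zero => exact ⟨0, by simp⟩
  | add x y _ _ hx hy =>
    obtain ⟨a, ha⟩ := hx
    obtain ⟨b, hb⟩ := hy
    refine ⟨a + b, fun s => ?_⟩
    simp only [ContinuousMap.add_apply, ha, hb, lp.coeFn_add, Pi.add_apply, add_mul]
    exact ((hsumm a s).tsum_add (hsumm b s)).symm
  | smul c x _ hx =>
    obtain ⟨a, ha⟩ := hx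
    refine ⟨c • a, fun s => ?_⟩
    simp [ha, mul_assoc, tsum_mul_left]

/-- Sequence-to-sequence universal approximation: every continuous map from a
compact subset `E ⊆ ℓᵖ` into `ℓ^q` can be uniformly approximated by shallow
networks whose inner weights are sequences `a_j ∈ ℓ^{p′}` acting via
`s ↦ Σ_n a_{j,n} s_n` and whose coefficients are vectors `v_j ∈ ℓ^q`. -/
theorem sequence_to_sequence_UAT
    (p p' q : ENNReal) [Fact (1 ≤ p)] [Fact (1 ≤ q)]
    (hp : 1 < p) (hp_top : p ≠ ⊤) (hpp' : 1 / p + 1 / p' = 1)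
    (hq : 1 ≤ q) (hq_top : q ≠ ⊤)
    (E : Set (lp (fun _ : ℕ => ℝ) p)) (hE : IsCompact E) (hEne : E.Nonempty)
    (η : ℝ → ℝ) (hη : Continuous η) (hηpoly : NotPolynomialOnAnyInterval η)
    (F : lp (fun _ : ℕ => ℝ) p → lp (fun _ : ℕ => ℝ) q) (hF : ContinuousOn F E)
    (ε : ℝ) (hε : 0 < ε) :
    ∃ (m : ℕ) (a : Fin m → lp (fun _ : ℕ => ℝ) p') (θ : Fin m → ℝ)
      (v : Fin m → lp (fun _ : ℕ => ℝ) q),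
      ∀ s ∈ E,
        ‖F s - ∑ j, η ((∑' n : ℕ, a j n * s n) - θ j) • v j‖ < ε := by
  have : CompactSpace E := isCompact_iff_compactSpace.1 hE
  have hconj : p'.toReal.HolderConjugate p.toReal := by
    refine (Real.holderConjugate_iff.2 ⟨?_, ?_⟩).symm
    · simpa using (ENNReal.toReal_lt_toReal ENNReal.one_ne_top hp_top).2 hp
    · have hpinv : p⁻¹ ≠ ⊤ := ENNReal.inv_ne_top.2 (one_pos.trans hp).ne'
      have hp'inv : p'⁻¹ ≠ ⊤ := fun h => by simp [h] at hpp'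
      rw [one_div, one_div] at hpp'
      have := congrArg ENNReal.toReal hpp'
      rwa [ENNReal.toReal_add hpinv hp'inv, ENNReal.toReal_inv, ENNReal.toReal_inv,
        ENNReal.toReal_one] at this
  have hpoly : ¬ ∃ P : Polynomial ℝ, ∀ x, (⟨η, hη⟩ : C(ℝ, ℝ)) x = P.eval x := by
    rintro ⟨P, hP⟩
    obtain ⟨x, -, hx⟩ := hηpoly 0 1 one_pos P
    exact hx (hP x)
  have hsep : ∀ ⦃x y : E⦄, x ≠ y → ∃ a ∈ lp.coordinateSpan p E, a x ≠ a y := by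
    intro x y hxy
    obtain ⟨i, hi⟩ : ∃ i, x.1 i ≠ y.1 i := by
      by_contra! h
      exact hxy (Subtype.ext (lp.ext (funext h)))
    exact ⟨_, Submodule.subset_span ⟨i, rfl⟩, hi⟩
  obtain ⟨m, a, θ, v, h⟩ := RidgeProfile.exists_norm_sub_sum_lt (lp.coordinateSpan p E) hsep
    ⟨η, hη⟩ hpoly ⟨E.domRestrict F, hF.domRestrict⟩ hε
  choose b hb using fun j => lp.exists_tsum_of_mem_coordinateSpan hconj (a j).2
  refine ⟨m, b, θ, v, fun s hs => ?_⟩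
  simpa [hb, Set.domRestrict] using h ⟨s, hs⟩
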